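/- arXiv:2601.01681 — 2 statements merged into one kernel-verified Lean document; each statement's English description precedes it below -/
import Mathlib

section
/- For every topological median algebra X, ind(𝓜𝓒) ≤ rank(X), where 𝓜𝓒 is the family of all continuous median-preserving maps f : X → [0,1]. -/
open Set

/-- A median algebra: a ternary operation invariant under permutations of its
arguments, with `m x y y = y` and the standard associativity law. -/
structure MedianStruct (X : Type*) where
  med : X → X → X → X
  med_perm : ∀ (σ : Equiv.Perm (Fin 3)) (v : Fin 3 → X),
    med (v (σ 0)) (v (σ 1)) (v (σ 2)) = med (v 0) (v 1) (v 2)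
  med_idem : ∀ x y : X, med x y y = y
  med_assoc : ∀ x y z u w : X,
    med (med x y z) u w = med x (med y u w) (med z u w)

namespace MedianStruct

variable {X : Type*}

/-- The interval `[x,y] = {z | m x y z = z}`. -/
def interval (M : MedianStruct X) (x y : X) : Set X := {z | M.med x y z = z}

/-- A set is convex if it contains the interval between any two of its points. -/
def IsConvex (M : MedianStruct X) (C : Set X) : Prop :=
  ∀ x ∈ C, ∀ y ∈ C, M.interval x y ⊆ C

/-- A halfspace: a convex set with convex complement. -/
def IsHalfspace (M : MedianStruct X) (H : Set X) : Prop :=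
  M.IsConvex H ∧ M.IsConvex Hᶜ

end MedianStruct

/-- Two sets are crossing if all four intersections of them/their complements
are nonempty. -/
def Crossing {X : Type*} (A B : Set X) : Prop :=
  (A ∩ B).Nonempty ∧ (A ∩ Bᶜ).Nonempty ∧ (Aᶜ ∩ B).Nonempty ∧ (Aᶜ ∩ Bᶜ).Nonempty

/-- A finite family of sets is (Rosenthal) independent. -/
def IndepSetFamily {X : Type*} {k : ℕ} (A : Fin k → Set X) : Prop :=
  ∀ P M : Finset (Fin k), Disjoint P M →
    ((⋂ i ∈ P, A i) ∩ ⋂ j ∈ M, (A j)ᶜ).Nonempty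

/-- The independence number of a family of sets: the supremum of the sizes of
independent finite subfamilies. -/
noncomputable def indSets {X : Type*} (𝒞 : Set (Set X)) : ℕ∞ :=
  ⨆ (k : ℕ) (_ : ∃ A : Fin k → Set X,
      (∀ i, A i ∈ 𝒞) ∧ Function.Injective A ∧ IndepSetFamily A), (k : ℕ∞)

/-- Majority (median) operation on `Bool`. -/
def boolMed (a b c : Bool) : Bool := (a && b) || (b && c) || (a && c)

/-- The coordinatewise majority median on a power of `Bool`. -/
def boolCubeMed (I : Type*) : MedianStruct (I → Bool) where
  med x y z := fun i => boolMed (x i) (y i) (z i)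
  med_perm σ v := by
    funext i
    exact (by decide :
      ∀ (τ : Equiv.Perm (Fin 3)) (w : Fin 3 → Bool),
        boolMed (w (τ 0)) (w (τ 1)) (w (τ 2)) = boolMed (w 0) (w 1) (w 2))
      σ (fun j => v j i)
  med_idem x y := by
    funext i
    exact (by decide : ∀ a b : Bool, boolMed a b b = b) (x i) (y i)
  med_assoc x y z u w := by
    funext i
    exact (by decide : ∀ a b c d e : Bool,
        boolMed (boolMed a b c) d e = boolMed a (boolMed b d e) (boolMed c d e))
      (x i) (y i) (z i) (u i) (w i)

/-- A median-preserving (MP) map between median algebras. -/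
def IsMedianHom {X Y : Type*} (M : MedianStruct X) (N : MedianStruct Y)
    (f : X → Y) : Prop :=
  ∀ x y z, f (M.med x y z) = N.med (f x) (f y) (f z)

/-- The rank of a median algebra: the supremum of the `n` such that the Boolean
hypercube `{0,1}ⁿ` embeds into it by an injective median-preserving map. -/
noncomputable def medRank {X : Type*} (M : MedianStruct X) : ℕ∞ :=
  ⨆ (n : ℕ) (_ : ∃ f : (Fin n → Bool) → X,
      Function.Injective f ∧ IsMedianHom (boolCubeMed (Fin n)) M f), (n : ℕ∞)

/-- The median operation on `ℝ`. -/
noncomputable def realMed (a b c : ℝ) : ℝ := max (max (min a b) (min b c)) (min a c)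

/-- A real-valued median-preserving function on a median algebra. -/
def IsMedianPreserving {X : Type*} (M : MedianStruct X) (f : X → ℝ) : Prop :=
  ∀ x y z, f (M.med x y z) = realMed (f x) (f y) (f z)

/-- A finite sequence of real functions is independent with witnessing
constants `a < b`. -/
def IndepFunFinWith {X : Type*} {k : ℕ} (f : Fin k → X → ℝ) (a b : ℝ) : Prop :=
  ∀ P M : Finset (Fin k), Disjoint P M →
    ((⋂ i ∈ P, {x | f i x ≤ a}) ∩ ⋂ j ∈ M, {x | b ≤ f j x}).Nonempty

/-- A finite sequence of real functions is independent. -/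
def IndepFunFin {X : Type*} {k : ℕ} (f : Fin k → X → ℝ) : Prop :=
  ∃ a b : ℝ, a < b ∧ IndepFunFinWith f a b

/-- The independence number of a family of real functions: the supremum of the
lengths of independent finite sequences in the family. -/
noncomputable def indFun {X : Type*} (F : Set (X → ℝ)) : ℕ∞ :=
  ⨆ (k : ℕ) (_ : ∃ f : Fin k → X → ℝ, (∀ i, f i ∈ F) ∧ IndepFunFin f), (k : ℕ∞)

/-- An infinite sequence of real functions is independent. -/
def IndepFunSeq {X : Type*} (f : ℕ → X → ℝ) : Prop :=
  ∃ a b : ℝ, a < b ∧ ∀ P M : Finset ℕ, Disjoint P M →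
    ((⋂ i ∈ P, {x | f i x ≤ a}) ∩ ⋂ j ∈ M, {x | b ≤ f j x}).Nonempty

/-- A finite set `S` is shattered by a family of sets `𝒟`. -/
def Shatters {Y : Type*} (𝒟 : Set (Set Y)) (S : Finset Y) : Prop :=
  ∀ T : Set Y, T ⊆ ↑S → ∃ D ∈ 𝒟, D ∩ ↑S = T

/-- The VC-dimension of a family of sets. -/
noncomputable def vcDim {Y : Type*} (𝒟 : Set (Set Y)) : ℕ∞ :=
  ⨆ (k : ℕ) (_ : ∃ S : Finset Y, S.card = k ∧ Shatters 𝒟 S), (k : ℕ∞)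

/-- The dual set system of `𝒞`: on the ground set `𝒞`, the sets
`R_x = {C ∈ 𝒞 | x ∈ C}` for `x ∈ X`. -/
def dualSystem {X : Type*} (𝒞 : Set (Set X)) : Set (Set ↥𝒞) :=
  {R | ∃ x : X, R = {C : ↥𝒞 | x ∈ (C : Set X)}}

/-- The family of all continuous median-preserving maps `X → [0,1]`. -/
def MCfam {X : Type*} [TopologicalSpace X] (M : MedianStruct X) : Set (X → ℝ) :=
  {f | Continuous f ∧ IsMedianPreserving M f ∧ ∀ x, f x ∈ Set.Icc (0 : ℝ) 1}

namespace MedianStruct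

variable {X : Type*} (M : MedianStruct X)

theorem med_swap_left (x y z : X) : M.med x y z = M.med y x z := by
  simpa [Equiv.swap_apply_def] using (M.med_perm (Equiv.swap 0 1) ![x, y, z]).symm

theorem med_swap_right (x y z : X) : M.med x y z = M.med x z y := by
  simpa [Equiv.swap_apply_def] using (M.med_perm (Equiv.swap 1 2) ![x, y, z]).symm

theorem med_rotate (x y z : X) : M.med x y z = M.med y z x := by
  rw [M.med_swap_left, M.med_swap_right]

theorem med_idem_left (x y : X) : M.med x x y = x := by
  rw [M.med_rotate, M.med_rotate, M.med_idem]

theorem med_med_self (x a b : X) : M.med (M.med x a b) a b = M.med x a b := by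
  rw [M.med_assoc, M.med_idem_left, M.med_swap_left b, M.med_idem]

/-- The map `x ↦ m x a b` is median-preserving. -/
theorem med_med_distrib (x y z a b : X) :
    M.med (M.med x y z) a b = M.med (M.med x a b) (M.med y a b) (M.med z a b) := by
  rw [← M.med_med_self, M.med_assoc x, M.med_swap_left x, M.med_assoc, M.med_med_self,
    M.med_swap_left]

theorem med_mem_interval (x p q : X) : M.med p q x ∈ M.interval p q := by
  change M.med p q (M.med p q x) = _
  rw [← M.med_rotate (M.med p q x), ← M.med_rotate x, M.med_med_self]

theorem med_mem_interval_left {p q v : X} (u : X) (hv : v ∈ M.interval p q) :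
    M.med p u v ∈ M.interval p q := by
  have hv' : M.med p q v = v := hv
  change M.med p q (M.med p u v) = M.med p u v
  rw [← M.med_rotate, M.med_rotate p u v, M.med_assoc, M.med_rotate v, hv', M.med_idem_left]

theorem interval_comm (p q : X) : M.interval p q = M.interval q p := by
  ext x
  simp only [interval, mem_ofPred_eq, M.med_swap_left p q]

theorem med_mem_interval_right {p q v : X} (u : X) (hv : v ∈ M.interval p q) :
    M.med q u v ∈ M.interval p q := by
  rw [interval_comm] at hv ⊢
  exact M.med_mem_interval_left u hv

theorem med_left_assoc (p u v w : X) :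
    M.med p (M.med p u v) w = M.med p u (M.med p v w) := by
  rw [M.med_rotate p _ w, M.med_rotate p u v, M.med_assoc, M.med_swap_left p w, M.med_idem,
    ← M.med_rotate p u, M.med_rotate v, M.med_swap_left w, M.med_swap_right p w]

theorem med_absorb {p q u : X} (v : X) (hu : u ∈ M.interval p q) :
    M.med p u (M.med q u v) = u := by
  have hu' : M.med p q u = u := hu
  rw [← M.med_rotate, ← M.med_rotate v, M.med_assoc, M.med_swap_left q, hu', M.med_swap_left u,
    M.med_idem, M.med_idem]

theorem med_distrib (p q u v w : X) :
    M.med p u (M.med q v w) = M.med q (M.med p u v) (M.med p u w) := by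
  rw [← M.med_rotate, M.med_assoc, M.med_rotate v, M.med_rotate w]

/-- The interval `[p, q]` is a distributive lattice with meet `m p u v` and
join `m q u v`. -/
abbrev intervalLattice (p q : X) : DistribLattice (M.interval p q) :=
  letI : Max (M.interval p q) := ⟨fun u v => ⟨M.med q u v, M.med_mem_interval_right _ v.2⟩⟩
  letI : Min (M.interval p q) := ⟨fun u v => ⟨M.med p u v, M.med_mem_interval_left _ v.2⟩⟩
  letI : Lattice (M.interval p q) := Lattice.mk'
    (fun u v => Subtype.ext (M.med_swap_right q u v))
    (fun u v w => Subtype.ext (M.med_left_assoc q u v w))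
    (fun u v => Subtype.ext (M.med_swap_right p u v))
    (fun u v w => Subtype.ext (M.med_left_assoc p u v w))
    (fun u v => Subtype.ext (M.med_absorb (p := q) v (M.interval_comm p q ▸ u.2)))
    (fun u v => Subtype.ext (M.med_absorb v u.2))
  DistribLattice.ofInfSupLe fun u v w => (Subtype.ext (M.med_distrib p q u v w)).le

section

attribute [local instance] intervalLattice

variable {M} {p q : X}

theorem coe_inf (u v : M.interval p q) : ((u ⊓ v : M.interval p q) : X) = M.med p u v := rfl

theorem coe_sup (u v : M.interval p q) : ((u ⊔ v : M.interval p q) : X) = M.med q u v := rfl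

theorem left_mem_interval : p ∈ M.interval p q := by
  change M.med p q p = p
  rw [M.med_swap_left, M.med_idem]

/-- `p` is the least element of `[p, q]`. -/
abbrev intervalOrderBot : OrderBot (M.interval p q) where
  bot := ⟨p, left_mem_interval⟩
  bot_le u := inf_eq_left.1 (Subtype.ext (M.med_idem_left p u))

theorem med_inf_coe (u v w c : M.interval p q) :
    M.med p (M.med u v w) c =
      M.med (u ⊓ c : M.interval p q) (v ⊓ c : M.interval p q) (w ⊓ c : M.interval p q) := by
  simp only [coe_inf]
  rw [M.med_rotate, M.med_med_distrib, M.med_rotate p u, M.med_rotate p v, M.med_rotate p w]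

theorem med_sup_coe (u v w c : M.interval p q) :
    M.med q (M.med u v w) c =
      M.med (u ⊔ c : M.interval p q) (v ⊔ c : M.interval p q) (w ⊔ c : M.interval p q) := by
  simp only [coe_sup]
  rw [M.med_rotate, M.med_med_distrib, M.med_rotate q u, M.med_rotate q v, M.med_rotate q w]

theorem med_coe_mem (u v w : M.interval p q) : M.med u v w ∈ M.interval p q := by
  have h (u : M.interval p q) : M.med u p q = u := by rw [M.med_rotate]; exact u.2
  change M.med p q (M.med u v w) = _
  rw [← M.med_rotate, M.med_med_distrib, h, h, h]

/-- Inside an interval, the median is the lattice median. -/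
theorem med_coe (u v w : M.interval p q) :
    M.med u v w = ((u ⊓ v ⊔ v ⊓ w ⊔ u ⊓ w : M.interval p q) : X) := by
  let t : M.interval p q := ⟨M.med u v w, med_coe_mem u v w⟩
  change (t : X) = _
  congr 1
  apply le_antisymm
  · have huv : t ≤ u ⊔ v := by
      refine sup_eq_right.1 (Subtype.ext ((med_sup_coe u v w _).trans ?_))
      rw [sup_eq_right.2 le_sup_left, sup_eq_right.2 le_sup_right, med_idem_left]
    have hvw : t ≤ v ⊔ w := by
      refine sup_eq_right.1 (Subtype.ext ((med_sup_coe u v w _).trans ?_))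
      rw [sup_eq_right.2 (le_sup_left : v ≤ v ⊔ w), sup_eq_right.2 le_sup_right, med_idem]
    have huw : t ≤ u ⊔ w := by
      refine sup_eq_right.1 (Subtype.ext ((med_sup_coe u v w _).trans ?_))
      rw [sup_eq_right.2 (le_sup_left : u ≤ u ⊔ w), sup_eq_right.2 le_sup_right,
        med_swap_left, med_idem]
    refine (le_inf (le_inf huv hvw) huw).trans ?_
    rw [sup_comm u v, ← sup_inf_left, inf_sup_right, inf_sup_left, inf_comm v u]
    exact sup_le_sup_left inf_le_left _
  · refine sup_le (sup_le ?_ ?_) ?_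
    · refine inf_eq_right.1 (Subtype.ext ((med_inf_coe u v w _).trans ?_))
      rw [inf_eq_right.2 inf_le_left, inf_eq_right.2 inf_le_right, med_idem_left]
    · refine inf_eq_right.1 (Subtype.ext ((med_inf_coe u v w _).trans ?_))
      rw [inf_eq_right.2 (inf_le_left : v ⊓ w ≤ v), inf_eq_right.2 inf_le_right, med_idem]
    · refine inf_eq_right.1 (Subtype.ext ((med_inf_coe u v w _).trans ?_))
      rw [inf_eq_right.2 (inf_le_left : u ⊓ w ≤ u), inf_eq_right.2 inf_le_right,
        med_swap_left, med_idem]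

end

end MedianStruct

theorem pred_finset_sup_iff {κ L : Type*} [SemilatticeSup L] [OrderBot L] {H : L → Prop}
    (hbot : ¬ H ⊥) (hsup : ∀ u v, H (u ⊔ v) ↔ H u ∨ H v) (s : Finset κ) (g : κ → L) :
    H (s.sup g) ↔ ∃ j ∈ s, H (g j) := by
  classical
  induction s using Finset.induction_on with
  | empty => simp [hbot]
  | insert a s ha ih => simp [hsup, ih]

section CubeLift

variable {ι L : Type*} [Fintype ι] [DecidableEq ι] [DistribLattice L] [OrderBot L]

/-- The join of the pairwise meets of a finite family. -/
def pairwiseInfSup (e : ι → L) : L :=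
  (Finset.univ.filter fun ij : ι × ι => ij.1 ≠ ij.2).sup fun ij => e ij.1 ⊓ e ij.2

/-- The map from the Boolean cube into a distributive lattice obtained by joining the
members of a family, after making them disjoint relative to their pairwise meets. -/
def cubeLift (e : ι → L) (S : ι → Bool) : L :=
  pairwiseInfSup e ⊔ (Finset.univ.filter fun i => S i = true).sup e

theorem cubeLift_sup (e : ι → L) (S T : ι → Bool) :
    cubeLift e (fun i => S i || T i) = cubeLift e S ⊔ cubeLift e T := by
  simp only [cubeLift, Bool.or_eq_true, Finset.filter_or, Finset.sup_union]
  exact sup_sup_distrib_left _ _ _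

theorem cubeLift_inf (e : ι → L) (S T : ι → Bool) :
    cubeLift e (fun i => S i && T i) = cubeLift e S ⊓ cubeLift e T := by
  simp only [cubeLift, ← sup_inf_left]
  apply le_antisymm
  · refine sup_le_sup_left (le_inf ?_ ?_) _ <;> apply Finset.sup_mono <;> intro i <;>
      simp +contextual
  · refine sup_le le_sup_left ?_
    rw [Finset.sup_inf_sup]
    refine Finset.sup_le fun ⟨i, j⟩ hij => ?_
    simp only [Finset.mem_product, Finset.mem_filter, Finset.mem_univ, true_and] at hij
    by_cases h : i = j
    · subst h
      refine le_sup_of_le_right (inf_le_left.trans (Finset.le_sup (f := e) ?_))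
      simp [hij]
    · refine le_sup_of_le_left ?_
      exact Finset.le_sup (f := fun ij : ι × ι => e ij.1 ⊓ e ij.2) (b := (i, j)) (by simp [h])

theorem cubeLift_boolMed (e : ι → L) (S T U : ι → Bool) :
    cubeLift e ((boolCubeMed ι).med S T U) =
      cubeLift e S ⊓ cubeLift e T ⊔ cubeLift e T ⊓ cubeLift e U ⊔
        cubeLift e S ⊓ cubeLift e U := by
  simp only [← cubeLift_inf, ← cubeLift_sup]
  rfl

/-- A two-valued lattice homomorphism that detects exactly the member `e i`
detects exactly the vertices of the cube with `i`-th coordinate `true`. -/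
theorem cubeLift_pred_iff {H : L → Prop} (hbot : ¬ H ⊥) (hsup : ∀ u v, H (u ⊔ v) ↔ H u ∨ H v)
    (hinf : ∀ u v, H (u ⊓ v) ↔ H u ∧ H v) {e : ι → L} {i : ι} (he : ∀ j, H (e j) ↔ j = i)
    (S : ι → Bool) : H (cubeLift e S) ↔ S i = true := by
  have hpair : ¬ H (pairwiseInfSup e) := by
    rw [pairwiseInfSup, pred_finset_sup_iff hbot hsup]
    rintro ⟨⟨j, l⟩, hjl, h⟩
    rw [hinf, he, he] at h
    exact (Finset.mem_filter.1 hjl).2 (h.1.trans h.2.symm)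
  simp [cubeLift, hsup, hpair, pred_finset_sup_iff hbot hsup, he]

end CubeLift

theorem lt_realMed_iff (a x y z : ℝ) :
    a < realMed x y z ↔ a < x ∧ a < y ∨ a < y ∧ a < z ∨ a < x ∧ a < z := by
  simp only [realMed, lt_max_iff, lt_min_iff, or_assoc]

open MedianStruct in
attribute [local instance] intervalLattice intervalOrderBot in
/-- Independent median-preserving functions yield an embedded Boolean cube. -/
theorem IndepFunFin.exists_cube {X : Type*} {M : MedianStruct X} {k : ℕ} {f : Fin k → X → ℝ}
    (hf : ∀ i, IsMedianPreserving M (f i)) (hind : IndepFunFin f) :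
    ∃ g : (Fin k → Bool) → X,
      Function.Injective g ∧ IsMedianHom (boolCubeMed (Fin k)) M g := by
  obtain ⟨a, b, hab, h⟩ := hind
  have hpt (P : Finset (Fin k)) : ∃ x, ∀ i, a < f i x ↔ i ∈ P := by
    obtain ⟨x, hx⟩ := h Pᶜ P disjoint_compl_left
    simp only [mem_inter_iff, mem_iInter, mem_ofPred_eq, Finset.mem_compl] at hx
    refine ⟨x, fun i => ⟨fun hi => ?_, fun hi => hab.trans_le (hx.2 i hi)⟩⟩
    by_contra hP
    exact (hx.1 i hP).not_gt hi
  choose x hx using hpt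
  let p := x ∅
  let q := x Finset.univ
  have hp (i : Fin k) : ¬ a < f i p := by simp [p, hx]
  have hq (i : Fin k) : a < f i q := by simp [q, hx]
  have hmed (i : Fin k) (u v w : X) := by
    have := lt_realMed_iff a (f i u) (f i v) (f i w)
    rwa [← hf i] at this
  let e (j : Fin k) : M.interval p q := ⟨_, M.med_mem_interval (x {j}) p q⟩
  have hlift (i : Fin k) (S : Fin k → Bool) : a < f i (cubeLift e S : M.interval p q) ↔ S i = true := by
    refine cubeLift_pred_iff (H := fun u : M.interval p q => a < f i u) (hp i) ?_ ?_ ?_ S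
    · intro u v
      simp only [coe_sup, hmed, hq i, true_and]
      tauto
    · intro u v
      simp only [coe_inf, hmed, hp i, false_and, false_or, or_false]
    · intro j
      simp only [e, hmed, hp i, hq i, hx, Finset.mem_singleton, true_and, false_and, false_or,
        or_false, eq_comm]
  refine ⟨fun S => (cubeLift e S : M.interval p q), fun S T hST => ?_, fun S T U => ?_⟩
  · funext i
    rw [Bool.eq_iff_iff, ← hlift, ← hlift]
    exact iff_of_eq (congrArg (fun y => a < f i y) hST)
  · simp only [cubeLift_boolMed, med_coe]

/-- for every topological median algebra, the independence number
of the family of all continuous median-preserving maps `X → [0,1]` is at most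
the rank of `X`. -/
theorem indFun_MC_le_medRank {X : Type*} [TopologicalSpace X] [T2Space X]
    (M : MedianStruct X)
    (hm : Continuous fun p : X × X × X => M.med p.1 p.2.1 p.2.2) :
    indFun (MCfam M) ≤ medRank M := by
  refine iSup₂_le fun k ⟨f, hf, hind⟩ => ?_
  exact le_iSup₂_of_le k (hind.exists_cube fun i => (hf i).2.1) le_rfl
end

section
/- Generalized Helly selection principle: let X be a median algebra in which every family of pairwise crossing halfspaces is finite (X has subinfinite rank; in particular this holds if X has finite rank). Let (f_n)_{n∈ℕ} be a uniformly bounded sequence of median-preserving functions f_n : X → ℝ. Then (f_n) admits a subsequence that converges pointwise on X, and the pointwise limit of this subsequence is again a median-preserving function X → ℝ. -/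
open Set

open Filter Topology

/-- A diagonal Ramsey-type selection: countably many relations that hold iteratively along the
hyperfilter hold, each from some index on, along a common subsequence. -/
theorem exists_strictMono_forall_lt_of_eventually_hyperfilter (r : ℕ → ℕ → ℕ → Prop)
    (h : ∀ e, ∀ᶠ i in (hyperfilter ℕ : Filter ℕ), ∀ᶠ j in (hyperfilter ℕ : Filter ℕ), r e i j) :
    ∃ φ : ℕ → ℕ, StrictMono φ ∧ ∀ e i j, e ≤ i → i < j → r e (φ i) (φ j) := by
  obtain ⟨p, hp, hpr⟩ := exists_seq_of_forall_finset_exists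
    (fun p : ℕ × ℕ => ∀ e ≤ p.1, ∀ᶠ j in (hyperfilter ℕ : Filter ℕ), r e p.2 j)
    (fun p q => p.1 < q.1 ∧ p.2 < q.2 ∧ ∀ e ≤ p.1, r e p.2 q.2) (by
      intro s hs
      have hgt : ∀ n : ℕ, ∀ᶠ i in (hyperfilter ℕ : Filter ℕ), n < i := fun n =>
        (Nat.hyperfilter_le_atTop (eventually_gt_atTop n))
      have h₁ : ∀ᶠ i in (hyperfilter ℕ : Filter ℕ), ∀ e ∈ Set.Iic (s.sup Prod.fst + 1),
          ∀ᶠ j in (hyperfilter ℕ : Filter ℕ), r e i j :=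
        ((Set.finite_Iic _).eventually_all).2 fun e _ => h e
      have h₂ : ∀ᶠ i in (hyperfilter ℕ : Filter ℕ), ∀ p ∈ s,
          p.2 < i ∧ ∀ e ∈ Set.Iic p.1, r e p.2 i :=
        (s.eventually_all).2 fun p hps =>
          (hgt p.2).and (((Set.finite_Iic _).eventually_all).2 fun e he => hs p hps e he)
      obtain ⟨i, hi₁, hi₂⟩ := (h₁.and h₂).exists
      exact ⟨(s.sup Prod.fst + 1, i), hi₁, fun p hps =>
        ⟨Nat.lt_succ_of_le (Finset.le_sup (f := Prod.fst) hps), hi₂ p hps⟩⟩)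
  have hmono : StrictMono fun n => (p n).1 := fun m n hmn => (hpr m n hmn).1
  exact ⟨fun n => (p n).2, fun m n hmn => (hpr m n hmn).2.1, fun e i j hei hij =>
    (hpr i j hij).2.2 e (hei.trans (hmono.le_apply))⟩

theorem realMed_le {a b c t : ℝ} (ha : a ≤ t) (hb : b ≤ t) : realMed a b c ≤ t := by
  simp [realMed, ha, hb]

theorem lt_realMed {a b c t : ℝ} (ha : t < a) (hb : t < b) : t < realMed a b c := by
  simp [realMed, ha, hb]

/-- Sublevel sets of median-preserving functions are halfspaces. -/
theorem IsMedianPreserving.isHalfspace_setOf_le {X : Type*} {M : MedianStruct X} {f : X → ℝ}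
    (hf : IsMedianPreserving M f) (a : ℝ) : M.IsHalfspace {x | f x ≤ a} := by
  constructor
  · intro x hx y hy z hz
    have hz' : M.med x y z = z := hz
    rw [Set.mem_ofPred_eq, ← hz', hf]
    exact realMed_le hx hy
  · intro x hx y hy z hz
    have hz' : M.med x y z = z := hz
    simp only [Set.mem_compl_iff, Set.mem_ofPred_eq, not_le] at hx hy ⊢
    rw [← hz', hf]
    exact lt_realMed hx hy

/-- A pointwise limit of median-preserving functions is median-preserving. -/
theorem IsMedianPreserving.of_tendsto {X ι : Type*} {M : MedianStruct X} {l : Filter ι} [l.NeBot]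
    {f : ι → X → ℝ} {g : X → ℝ} (hf : ∀ n, IsMedianPreserving M (f n))
    (hg : ∀ x, Tendsto (fun n => f n x) l (𝓝 (g x))) : IsMedianPreserving M g := by
  intro x y z
  refine tendsto_nhds_unique (hg (M.med x y z)) ?_
  simp only [hf _ x y z, realMed]
  exact (((hg x).min (hg y)).max ((hg y).min (hg z))).max ((hg x).min (hg z))

/-- In a median algebra of subinfinite rank, sublevel and superlevel sets of a sequence of
median-preserving functions satisfy one of four disjointness patterns, iteratively along the
hyperfilter. -/
theorem eventually_hyperfilter_disjoint_of_subinfinite_rank {X : Type*} {M : MedianStruct X}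
    (hsub : ∀ 𝒜 : Set (Set X), (∀ A ∈ 𝒜, M.IsHalfspace A) →
      𝒜.Pairwise Crossing → 𝒜.Finite)
    {f : ℕ → X → ℝ} (hf : ∀ n, IsMedianPreserving M (f n)) {a b : ℝ} (hab : a < b) :
    (∀ᶠ i in (hyperfilter ℕ : Filter ℕ), ∀ᶠ j in (hyperfilter ℕ : Filter ℕ),
        ¬ ∃ x, f i x ≤ a ∧ f j x ≤ a) ∨
    (∀ᶠ i in (hyperfilter ℕ : Filter ℕ), ∀ᶠ j in (hyperfilter ℕ : Filter ℕ),
        ¬ ∃ x, f i x ≤ a ∧ b ≤ f j x) ∨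
    (∀ᶠ i in (hyperfilter ℕ : Filter ℕ), ∀ᶠ j in (hyperfilter ℕ : Filter ℕ),
        ¬ ∃ x, b ≤ f i x ∧ f j x ≤ a) ∨
    (∀ᶠ i in (hyperfilter ℕ : Filter ℕ), ∀ᶠ j in (hyperfilter ℕ : Filter ℕ),
        ¬ ∃ x, b ≤ f i x ∧ b ≤ f j x) := by
  by_contra! hcon
  obtain ⟨h₁, h₂, h₃, h₄⟩ := hcon
  have h : ∀ᶠ i in (hyperfilter ℕ : Filter ℕ), ∀ᶠ j in (hyperfilter ℕ : Filter ℕ),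
      (∃ x, f i x ≤ a ∧ f j x ≤ a) ∧ (∃ x, f i x ≤ a ∧ b ≤ f j x) ∧
      (∃ x, b ≤ f i x ∧ f j x ≤ a) ∧ (∃ x, b ≤ f i x ∧ b ≤ f j x) := by
    filter_upwards [h₁, h₂, h₃, h₄] with i h₁ h₂ h₃ h₄
    exact h₁.and (h₂.and (h₃.and h₄))
  obtain ⟨φ, -, hφ⟩ :=
    exists_strictMono_forall_lt_of_eventually_hyperfilter (fun _ => _) fun _ => h
  set A : ℕ → Set X := fun n => {x | f (φ n) x ≤ a}
  have hlt : ∀ i j, i < j → Crossing (A i) (A j) ∧ Crossing (A j) (A i) := by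
    intro i j hij
    obtain ⟨⟨x, hx, hx'⟩, ⟨y, hy, hy'⟩, ⟨z, hz, hz'⟩, ⟨w, hw, hw'⟩⟩ :=
      hφ 0 i j (Nat.zero_le i) hij
    have hy'' := not_le.2 (hab.trans_le hy')
    have hz'' := not_le.2 (hab.trans_le hz)
    have hw₁ := not_le.2 (hab.trans_le hw)
    have hw₂ := not_le.2 (hab.trans_le hw')
    exact ⟨⟨⟨x, hx, hx'⟩, ⟨y, hy, hy''⟩, ⟨z, hz'', hz'⟩, ⟨w, hw₁, hw₂⟩⟩,
      ⟨⟨x, hx', hx⟩, ⟨z, hz', hz''⟩, ⟨y, hy'', hy⟩, ⟨w, hw₂, hw₁⟩⟩⟩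
  have hne : ∀ i j, i ≠ j → Crossing (A i) (A j) := fun i j hij =>
    hij.lt_or_gt.elim (fun h => (hlt i j h).1) fun h => (hlt j i h).2
  have hinj : Function.Injective A := by
    intro i j hij
    by_contra hne'
    obtain ⟨-, ⟨x, hx, hx'⟩, -⟩ := hne i j hne'
    exact hx' (hij ▸ hx)
  refine Set.infinite_range_of_injective hinj (hsub _ ?_ ?_)
  · rintro _ ⟨n, rfl⟩
    exact (hf _).isHalfspace_setOf_le a
  · rintro _ ⟨i, rfl⟩ _ ⟨j, rfl⟩ hij
    exact hne i j fun h => hij (congrArg A h)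

/-- In a median algebra of subinfinite rank, the absence of oscillation across `[a, b]` along a
subsequence is controlled by a relation between indices that holds iteratively along the
hyperfilter. -/
theorem exists_rel_no_upcrossings_of_subinfinite_rank {X : Type*} {M : MedianStruct X}
    (hsub : ∀ 𝒜 : Set (Set X), (∀ A ∈ 𝒜, M.IsHalfspace A) →
      𝒜.Pairwise Crossing → 𝒜.Finite)
    {f : ℕ → X → ℝ} (hf : ∀ n, IsMedianPreserving M (f n)) {a b : ℝ} (hab : a < b) :
    ∃ r : ℕ → ℕ → Prop,
      (∀ᶠ i in (hyperfilter ℕ : Filter ℕ), ∀ᶠ j in (hyperfilter ℕ : Filter ℕ), r i j) ∧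
      ∀ (φ : ℕ → ℕ) (N : ℕ), (∀ i j, N ≤ i → i < j → r (φ i) (φ j)) →
        ∀ x, ¬ ((∃ᶠ n in atTop, f (φ n) x < a) ∧ ∃ᶠ n in atTop, b < f (φ n) x) := by
  rcases eventually_hyperfilter_disjoint_of_subinfinite_rank hsub hf hab with h | h | h | h <;>
    refine ⟨_, h, fun φ N hφ x ⟨hx, hx'⟩ => ?_⟩ <;>
    rw [frequently_atTop] at hx hx'
  · obtain ⟨i, hi, hia⟩ := hx N
    obtain ⟨j, hj, hja⟩ := hx (i + 1)
    exact hφ i j hi hj ⟨x, hia.le, hja.le⟩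
  · obtain ⟨i, hi, hia⟩ := hx N
    obtain ⟨j, hj, hjb⟩ := hx' (i + 1)
    exact hφ i j hi hj ⟨x, hia.le, hjb.le⟩
  · obtain ⟨i, hi, hib⟩ := hx' N
    obtain ⟨j, hj, hja⟩ := hx (i + 1)
    exact hφ i j hi hj ⟨x, hib.le, hja.le⟩
  · obtain ⟨i, hi, hib⟩ := hx' N
    obtain ⟨j, hj, hjb⟩ := hx' (i + 1)
    exact hφ i j hi hj ⟨x, hib.le, hjb.le⟩

/-- Generalized Helly Selection Principle: if every family of
pairwise crossing halfspaces of `X` is finite, then every uniformly bounded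
sequence of median-preserving functions `X → ℝ` admits a pointwise convergent
subsequence whose pointwise limit is again median-preserving. -/
theorem helly_selection_of_subinfinite_rank {X : Type*} (M : MedianStruct X)
    (hsub : ∀ 𝒜 : Set (Set X), (∀ A ∈ 𝒜, M.IsHalfspace A) →
      𝒜.Pairwise Crossing → 𝒜.Finite)
    (f : ℕ → X → ℝ) (hf : ∀ n, IsMedianPreserving M (f n))
    (C : ℝ) (hbdd : ∀ n x, |f n x| ≤ C) :
    ∃ φ : ℕ → ℕ, StrictMono φ ∧ ∃ g : X → ℝ,
      (∀ x, Filter.Tendsto (fun n => f (φ n) x) Filter.atTop (nhds (g x))) ∧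
      IsMedianPreserving M g := by
  have hrel : ∀ q : ℚ × ℚ, ∃ r : ℕ → ℕ → Prop,
      (∀ᶠ i in (hyperfilter ℕ : Filter ℕ), ∀ᶠ j in (hyperfilter ℕ : Filter ℕ), r i j) ∧
      ((q.1 : ℝ) < q.2 → ∀ (φ : ℕ → ℕ) (N : ℕ), (∀ i j, N ≤ i → i < j → r (φ i) (φ j)) →
        ∀ x, ¬ ((∃ᶠ n in atTop, f (φ n) x < q.1) ∧ ∃ᶠ n in atTop, q.2 < f (φ n) x)) := by
    intro q
    by_cases hq : (q.1 : ℝ) < q.2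
    · obtain ⟨r, hr, hr'⟩ := exists_rel_no_upcrossings_of_subinfinite_rank hsub hf hq
      exact ⟨r, hr, fun _ => hr'⟩
    · exact ⟨fun _ _ => True, by simp, fun h => absurd h hq⟩
  choose r hr hr' using hrel
  obtain ⟨s, hs⟩ := exists_surjective_nat (ℚ × ℚ)
  obtain ⟨φ, hφ, hrφ⟩ :=
    exists_strictMono_forall_lt_of_eventually_hyperfilter (fun e => r (s e)) fun e => hr (s e)
  have hlim : ∀ x, ∃ c, Tendsto (fun n => f (φ n) x) atTop (𝓝 c) := by
    intro x
    refine tendsto_of_no_upcrossings Rat.denseRange_cast ?_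
      (isBoundedUnder_of ⟨C, fun n => (abs_le.1 (hbdd _ x)).2⟩)
      (isBoundedUnder_of ⟨-C, fun n => (abs_le.1 (hbdd _ x)).1⟩)
    rintro _ ⟨p, rfl⟩ _ ⟨q, rfl⟩ hpq
    obtain ⟨e, he⟩ := hs (p, q)
    refine hr' (p, q) hpq φ e (fun i j hi hij => ?_) x
    simpa [he] using hrφ e i j hi hij
  choose g hg using hlim
  exact ⟨φ, hφ, g, hg, IsMedianPreserving.of_tendsto (fun n => hf (φ n)) hg⟩
end
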